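/- arXiv:2602.06462 — 3 statements merged into one kernel-verified Lean document; each statement's English description precedes it below -/
import Mathlib

section
/- Expectation of the group-mean baseline term: for every Z ≥ 1, ∑_{v : Fin Z → A} P(v) * ((1/Z) * ∑_{z : Fin Z} R̄(v) * ρ (v z)) • D_{v z}, summed appropriately (i.e., ∑_v P(v) • ((1/Z) ∑_z (R̄(v) * ρ(v z)) • D_{v z})), equals (1/Z) • fderiv ℝ J θ₀; that is, under i.i.d. sampling of Z actions from μ, the expected contribution of the within-group mean baseline to the likelihood-ratio gradient equals (1/Z) times the policy gradient of J at θ₀. -/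
/-- The i.i.d. expectation of a product of functions of two coordinates. -/
theorem sum_iid_mul_apply {ι A : Type*} [Fintype ι] [DecidableEq ι] [Fintype A]
    {μ : A → ℝ} (hμsum : ∑ a, μ a = 1) (g h : A → ℝ) (j z : ι) :
    ∑ v : ι → A, (∏ i, μ (v i)) * (g (v j) * h (v z)) =
      if j = z then ∑ a, μ a * (g a * h a) else (∑ a, μ a * g a) * ∑ a, μ a * h a := by
  have key : ∀ v : ι → A, (∏ i, μ (v i)) * (g (v j) * h (v z)) =
      ∏ i, μ (v i) * ((if i = j then g (v i) else 1) * (if i = z then h (v i) else 1)) := by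
    intro v
    simp only [Finset.prod_mul_distrib, Fintype.prod_ite_eq']
  have fubini := Finset.prod_univ_sum (fun _ : ι => (Finset.univ : Finset A))
    (fun i a => μ a * ((if i = j then g a else 1) * (if i = z then h a else 1)))
  rw [Fintype.piFinset_univ] at fubini
  rw [Finset.sum_congr rfl fun v _ => key v, ← fubini]
  split_ifs with hjz
  · subst hjz
    rw [Fintype.prod_eq_single j fun i hi => by simp [hi, hμsum]]
    simp
  · rw [Fintype.prod_eq_mul j z hjz fun i hi => by simp [hi.1, hi.2, hμsum]]
    simp [hjz, Ne.symm hjz]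

/-- If `h` is centred, only the matching summand of a sum over the sample correlates with it. -/
theorem sum_iid_sum_mul_apply {ι A : Type*} [Fintype ι] [DecidableEq ι] [Fintype A]
    {μ : A → ℝ} (hμsum : ∑ a, μ a = 1) (g : A → ℝ) {h : A → ℝ} (hh : ∑ a, μ a * h a = 0)
    (z : ι) :
    ∑ v : ι → A, (∏ i, μ (v i)) * ((∑ j, g (v j)) * h (v z)) = ∑ a, μ a * (g a * h a) := by
  simp_rw [Finset.sum_mul, Finset.mul_sum]
  rw [Finset.sum_comm]
  simp [sum_iid_mul_apply hμsum, hh]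

/-- Expectation of the group-mean baseline term: under i.i.d. sampling of `Z` actions from
`μ`, the expected contribution of the within-group mean baseline to the likelihood-ratio
gradient equals `(1/Z)` times the policy gradient of `J` at `θ₀`. -/
theorem group_mean_baseline_expectation
    {E : Type*} [NormedAddCommGroup E] [NormedSpace ℝ E]
    {A : Type*} [Fintype A] [Nonempty A]
    (π : E → A → ℝ) (θ₀ : E) (R : A → ℝ) (μ : A → ℝ)
    (hpos : ∀ θ a, 0 < π θ a)
    (hsum : ∀ θ, ∑ a, π θ a = 1)
    (hdiff : ∀ a, DifferentiableAt ℝ (fun θ => π θ a) θ₀)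
    (hμpos : ∀ a, 0 < μ a)
    (hμsum : ∑ a, μ a = 1)
    (Z : ℕ) (hZ : 1 ≤ Z) :
    ∑ v : Fin Z → A,
        (∏ i, μ (v i)) •
          ((1 / (Z : ℝ)) •
            ∑ z : Fin Z,
              (((1 / (Z : ℝ)) * ∑ j : Fin Z, R (v j)) * (π θ₀ (v z) / μ (v z))) •
                fderiv ℝ (fun θ => Real.log (π θ (v z))) θ₀)
      = (1 / (Z : ℝ)) • fderiv ℝ (fun θ => ∑ a, π θ a * R a) θ₀ := by
  set G : A → E →L[ℝ] ℝ := fun a => (π θ₀ a / μ a) • fderiv ℝ (fun θ => Real.log (π θ a)) θ₀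
    with hG
  have hμG : ∀ a, μ a • G a = fderiv ℝ (fun θ => π θ a) θ₀ := by
    intro a
    have hμ := (hμpos a).ne'
    have hπ := (hpos θ₀ a).ne'
    rw [hG]
    dsimp only
    rw [fderiv.log (hdiff a) hπ, smul_smul, smul_smul,
      show μ a * (π θ₀ a / μ a) * (π θ₀ a)⁻¹ = 1 by field_simp, one_smul]
  have hcentred : ∑ a, μ a • G a = 0 := by
    simp_rw [hμG]
    rw [← fderiv_fun_sum fun a _ => hdiff a]
    simp [hsum]
  have hJ : fderiv ℝ (fun θ => ∑ a, π θ a * R a) θ₀ = ∑ a, R a • μ a • G a := by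
    rw [fderiv_fun_sum fun a _ => (hdiff a).mul_const (R a)]
    exact Finset.sum_congr rfl fun a _ => by rw [fderiv_mul_const (hdiff a), hμG]
  have hZ0 : (Z : ℝ) ≠ 0 := by positivity
  rw [hJ]
  ext x
  have hcx : ∑ a, μ a * G a x = 0 := by simpa using congrArg (fun L => L x) hcentred
  have hgroup := fun z : Fin Z => sum_iid_sum_mul_apply hμsum R hcx z
  calc
    _ = ∑ v : Fin Z → A, ∑ z, 1 / (Z : ℝ) * (1 / Z) *
          ((∏ i, μ (v i)) * ((∑ j, R (v j)) * G (v z) x)) := by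
      simp only [hG, sum_apply, smul_apply, smul_eq_mul]
      refine Finset.sum_congr rfl fun v _ => ?_
      rw [Finset.mul_sum, Finset.mul_sum]
      exact Finset.sum_congr rfl fun z _ => by ring
    _ = 1 / (Z : ℝ) * ∑ a, μ a * (R a * G a x) := by
      rw [Finset.sum_comm]
      simp_rw [← Finset.mul_sum, hgroup]
      simp only [Finset.sum_const, Finset.card_univ, Fintype.card_fin, nsmul_eq_mul]
      field_simp
    _ = _ := by
      simp only [sum_apply, smul_apply, smul_eq_mul]
      exact congrArg _ (Finset.sum_congr rfl fun a _ => by ring)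
end

section
/- Per-state version of the step-level policy gradient (Theorem 1): for every Z ≥ 1, ∑_{v : Fin Z → A} P(v) • ((1/Z) ∑_{z : Fin Z} (ρ (v z) * (R (v z) − R̄(v))) • D_{v z}) = ((Z − 1)/Z) • fderiv ℝ J θ₀; that is, the expectation, under i.i.d. sampling of Z actions from the behavior distribution μ, of the unclipped likelihood-ratio gradient estimator with within-group mean baseline equals (Z−1)/Z times the policy gradient of the expected return J at θ₀. -/
section ProductExpectation

variable {ι A : Type*} [Fintype ι] [DecidableEq ι] [Fintype A]

/-- Under a product distribution, the expectation of a function of one coordinate is its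
expectation under the marginal. -/
theorem sum_prod_mul_apply (μ : A → ℝ) (hμ : ∑ a, μ a = 1) (f : A → ℝ) (z : ι) :
    ∑ v : ι → A, (∏ i, μ (v i)) * f (v z) = ∑ a, μ a * f a := by
  have h := Fintype.prod_sum fun (i : ι) (a : A) => μ a * if i = z then f a else 1
  simp only [Finset.prod_mul_distrib, Finset.prod_ite_eq', Finset.mem_univ, if_true] at h
  rw [← h, Finset.prod_eq_single z]
  · simp
  · intro i _ hi
    simp [hi, hμ]
  · simp

/-- Under a product distribution, functions of two distinct coordinates are uncorrelated. -/
theorem sum_prod_mul_apply_mul_apply (μ : A → ℝ) (hμ : ∑ a, μ a = 1) (f g : A → ℝ)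
    {z j : ι} (hzj : z ≠ j) :
    ∑ v : ι → A, (∏ i, μ (v i)) * (f (v z) * g (v j)) =
      (∑ a, μ a * f a) * ∑ a, μ a * g a := by
  have h := Fintype.prod_sum fun (i : ι) (a : A) =>
    μ a * ((if i = z then f a else 1) * if i = j then g a else 1)
  simp only [Finset.prod_mul_distrib, Finset.prod_ite_eq', Finset.mem_univ, if_true] at h
  rw [← h, Fintype.prod_eq_mul z j hzj]
  · simp [hzj, hzj.symm]
  · rintro i ⟨hiz, hij⟩
    simp [hiz, hij, hμ]

/-- If `G` has mean zero under `μ`, the sample covariance of `G` and `R` over an i.i.d. sample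
indexed by `ι` has expectation `(|ι| - 1) / |ι|` times the mean of `G * R`. -/
theorem sum_prod_mul_sample_covariance [Nonempty ι] (μ : A → ℝ) (hμ : ∑ a, μ a = 1)
    (G R : A → ℝ) (hG : ∑ a, μ a * G a = 0) :
    ∑ v : ι → A, (∏ i, μ (v i)) * (1 / (Fintype.card ι : ℝ) *
        ∑ z, G (v z) * (R (v z) - 1 / (Fintype.card ι : ℝ) * ∑ j, R (v j))) =
      ((Fintype.card ι : ℝ) - 1) / Fintype.card ι * ∑ a, μ a * (G a * R a) := by
  have hpair (z j : ι) : ∑ v : ι → A, (∏ i, μ (v i)) * (G (v z) * R (v j)) =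
      if z = j then ∑ a, μ a * (G a * R a) else 0 := by
    split_ifs with h
    · subst h
      exact sum_prod_mul_apply μ hμ (fun a => G a * R a) z
    · rw [sum_prod_mul_apply_mul_apply μ hμ G R h, hG, zero_mul]
  set n : ℝ := (Fintype.card ι : ℝ) with hn
  have hn0 : n ≠ 0 := by simp [hn]
  have hexpand (v : ι → A) : (∏ i, μ (v i)) * (1 / n *
        ∑ z, G (v z) * (R (v z) - 1 / n * ∑ j, R (v j))) =
      1 / n * ∑ z, ((∏ i, μ (v i)) * (G (v z) * R (v z)) -
        1 / n * ∑ j, (∏ i, μ (v i)) * (G (v z) * R (v j))) := by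
    rw [mul_left_comm, Finset.mul_sum]
    congr 1
    refine Finset.sum_congr rfl fun z _ => ?_
    rw [← Finset.mul_sum, ← Finset.mul_sum]
    ring
  simp_rw [hexpand]
  rw [← Finset.mul_sum, Finset.sum_comm]
  have hinner (z : ι) : ∑ v : ι → A, ((∏ i, μ (v i)) * (G (v z) * R (v z)) -
        1 / n * ∑ j, (∏ i, μ (v i)) * (G (v z) * R (v j))) =
      (1 - 1 / n) * ∑ a, μ a * (G a * R a) := by
    rw [Finset.sum_sub_distrib, ← Finset.mul_sum, Finset.sum_comm]
    simp_rw [hpair]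
    simp
    ring
  simp_rw [hinner]
  rw [Finset.sum_const, Finset.card_univ, nsmul_eq_mul, ← hn]
  field_simp

end ProductExpectation

/-- Per-state version of the step-level policy gradient (Theorem 1): the expectation, under
i.i.d. sampling of `Z` actions from the behavior distribution `μ`, of the unclipped
likelihood-ratio gradient estimator with within-group mean baseline equals `(Z-1)/Z` times
the policy gradient of the expected return `J` at `θ₀`. -/
theorem step_level_policy_gradient_per_state
    {E : Type*} [NormedAddCommGroup E] [NormedSpace ℝ E]
    {A : Type*} [Fintype A] [Nonempty A]
    (π : E → A → ℝ) (θ₀ : E) (R : A → ℝ) (μ : A → ℝ)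
    (hpos : ∀ θ a, 0 < π θ a)
    (hsum : ∀ θ, ∑ a, π θ a = 1)
    (hdiff : ∀ a, DifferentiableAt ℝ (fun θ => π θ a) θ₀)
    (hμpos : ∀ a, 0 < μ a)
    (hμsum : ∑ a, μ a = 1)
    (Z : ℕ) (hZ : 1 ≤ Z) :
    ∑ v : Fin Z → A,
        (∏ i, μ (v i)) •
          ((1 / (Z : ℝ)) •
            ∑ z : Fin Z,
              ((π θ₀ (v z) / μ (v z)) *
                  (R (v z) - (1 / (Z : ℝ)) * ∑ j : Fin Z, R (v j))) •
                fderiv ℝ (fun θ => Real.log (π θ (v z))) θ₀)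
      = (((Z : ℝ) - 1) / (Z : ℝ)) • fderiv ℝ (fun θ => ∑ a, π θ a * R a) θ₀ := by
  have : Nonempty (Fin Z) := ⟨⟨0, hZ⟩⟩
  have hscore (a : A) : fderiv ℝ (fun θ => Real.log (π θ a)) θ₀ =
      (π θ₀ a)⁻¹ • fderiv ℝ (fun θ => π θ a) θ₀ :=
    fderiv.log (hdiff a) (hpos θ₀ a).ne'
  have hweight (a : A) (x : E) :
      μ a * (π θ₀ a / μ a * fderiv ℝ (fun θ => Real.log (π θ a)) θ₀ x) =
        fderiv ℝ (fun θ => π θ a) θ₀ x := by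
    have := (hpos θ₀ a).ne'
    have := (hμpos a).ne'
    rw [hscore, smul_apply, smul_eq_mul]
    field_simp
  have hderiv_sum : ∑ a, fderiv ℝ (fun θ => π θ a) θ₀ = 0 := by
    rw [← fderiv_fun_sum fun a _ => hdiff a]
    simp [hsum]
  have hderiv_return : fderiv ℝ (fun θ => ∑ a, π θ a * R a) θ₀ =
      ∑ a, R a • fderiv ℝ (fun θ => π θ a) θ₀ := by
    rw [fderiv_fun_sum fun a _ => (hdiff a).mul_const (R a)]
    exact Finset.sum_congr rfl fun a _ => fderiv_mul_const (hdiff a) (R a)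
  ext x
  have h := sum_prod_mul_sample_covariance (ι := Fin Z) μ hμsum
    (fun a => π θ₀ a / μ a * fderiv ℝ (fun θ => Real.log (π θ a)) θ₀ x) R (by
      simpa [hweight] using congrArg (fun L : E →L[ℝ] ℝ => L x) hderiv_sum)
  have hreturn_apply : ∑ a, R a * fderiv ℝ (fun θ => π θ a) θ₀ x =
      ∑ a, μ a * (π θ₀ a / μ a * fderiv ℝ (fun θ => Real.log (π θ a)) θ₀ x * R a) := by
    refine Finset.sum_congr rfl fun a _ => ?_
    rw [← hweight a x]
    ring
  rw [hderiv_return]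
  simp only [sum_apply, smul_apply, smul_eq_mul]
  rw [hreturn_apply]
  simpa only [Fintype.card_fin, mul_right_comm _ (R _ - _)] using h
end

section
/- Theorem 2 (overall policy gradient of the mixed objective): for every Z ≥ 1 and weights α_step, α_term ∈ ℝ, α_step • ∑_{t ∈ T} ω t • G_step(t) + α_term • G_term = fderiv ℝ J_mix θ₀, where G_step(t) = ∑_q p q • ∑_s d_t q s • ∑_{v : Fin Z → A} P_s(v) • ((1/Z) ∑_z (ρ_s (v z) * (r q s (v z) − R̄_{q,s,t}(v))) • D_{s, v z}) is the expected step-wise estimator at timestep t, G_term = ∑_q p q • ∑_o (Π θ_old q o * (Π θ₀ q o / Π θ_old q o) * (R_term q o − b q)) • D'_{q,o} is the expected terminal estimator, and J_mix θ = α_step * ((Z−1)/Z) * ∑_t ω t * J_t θ + α_term * J_seq θ with J_t θ = ∑_q p q * ∑_s d_t q s * ∑_a π θ s a * r q s a and J_seq θ = ∑_q p q * ∑_o Π θ q o * R_term q o. Thus in expectation the combined step-wise plus terminal loss gradient equals the gradient of the single mixed objective J_mix. -/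
theorem sum_pi_prod_smul_apply {ι A M : Type*} [Fintype ι] [DecidableEq ι] [Fintype A]
    [AddCommGroup M] [Module ℝ M] (μ : A → ℝ) (F : A → M) (z : ι)
    (H : ({j // j ≠ z} → A) → ℝ) :
    ∑ v : ι → A, (∏ i, μ (v i)) • (H (fun j => v j) • F (v z)) =
      (∑ w : {j // j ≠ z} → A, (∏ j, μ (w j)) * H w) • ∑ a, μ a • F a := by
  rw [← (Equiv.funSplitAt z A).symm.sum_comp, Fintype.sum_prod_type_right, Finset.sum_smul]
  refine Finset.sum_congr rfl fun w _ => ?_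
  rw [Finset.smul_sum]
  refine Finset.sum_congr rfl fun a _ => ?_
  have hw : ∀ j : {j // j ≠ z}, (Equiv.funSplitAt z A).symm (a, w) j = w j := fun j => by
    simp [Equiv.funSplitAt, Equiv.piSplitAt, j.2]
  have ha : (Equiv.funSplitAt z A).symm (a, w) z = a := by
    simp [Equiv.funSplitAt, Equiv.piSplitAt]
  rw [Fintype.prod_eq_mul_prod_subtype_ne _ z]
  simp only [hw, ha, smul_smul]
  congr 1
  ring

theorem sum_pi_prod_smul_eval {ι A M : Type*} [Fintype ι] [DecidableEq ι] [Fintype A]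
    [AddCommGroup M] [Module ℝ M] (μ : A → ℝ) (hμ : ∑ a, μ a = 1) (F : A → M) (z : ι) :
    ∑ v : ι → A, (∏ i, μ (v i)) • F (v z) = ∑ a, μ a • F a := by
  have h := sum_pi_prod_smul_apply μ F z fun _ => 1
  simpa [← Fintype.prod_sum, hμ] using h

theorem sum_pi_prod_smul_eval_eval {ι A M : Type*} [Fintype ι] [DecidableEq ι] [Fintype A]
    [AddCommGroup M] [Module ℝ M] (μ : A → ℝ) (F : A → M) (hF : ∑ a, μ a • F a = 0)
    (r : A → ℝ) {z j : ι} (hj : j ≠ z) :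
    ∑ v : ι → A, (∏ i, μ (v i)) • (r (v j) • F (v z)) = 0 := by
  have h := sum_pi_prod_smul_apply μ F z fun w => r (w ⟨j, hj⟩)
  rwa [hF, smul_zero] at h

/-- Subtracting the group mean, which contains the sample itself, from the reward of each of `Z`
independent samples shrinks the expectation of a centred estimator by the factor `(Z - 1) / Z`. -/
theorem sum_pi_prod_smul_group_mean_baseline {A M : Type*} [Fintype A]
    [AddCommGroup M] [Module ℝ M] (μ : A → ℝ) (hμ : ∑ a, μ a = 1) (F : A → M)
    (hF : ∑ a, μ a • F a = 0) (r : A → ℝ) {Z : ℕ} (hZ : 1 ≤ Z) :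
    ∑ v : Fin Z → A, (∏ i, μ (v i)) • ((1 / (Z : ℝ)) • ∑ z : Fin Z,
        (r (v z) - (1 / (Z : ℝ)) * ∑ j : Fin Z, r (v j)) • F (v z)) =
      (((Z : ℝ) - 1) / Z) • ∑ a, μ a • (r a • F a) := by
  have hZ0 : (Z : ℝ) ≠ 0 := by positivity
  have hdiag (z : Fin Z) : ∑ v : Fin Z → A, (∏ i, μ (v i)) • (r (v z) • F (v z)) =
      ∑ a, μ a • (r a • F a) :=
    sum_pi_prod_smul_eval μ hμ (fun a => r a • F a) z
  have hmean (z : Fin Z) : ∑ v : Fin Z → A, (∏ i, μ (v i)) • ((∑ j, r (v j)) • F (v z)) =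
      ∑ a, μ a • (r a • F a) := by
    simp_rw [Finset.sum_smul, Finset.smul_sum]
    rw [Finset.sum_comm, Finset.sum_eq_single z, hdiag]
    · exact fun j _ hj => sum_pi_prod_smul_eval_eval μ F hF r hj
    · simp
  have hz (z : Fin Z) : ∑ v : Fin Z → A, (∏ i, μ (v i)) •
      ((r (v z) - (1 / (Z : ℝ)) * ∑ j, r (v j)) • F (v z)) =
      (1 - 1 / (Z : ℝ)) • ∑ a, μ a • (r a • F a) := by
    simp_rw [sub_smul, smul_sub, mul_smul, smul_comm _ (1 / (Z : ℝ))]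
    rw [Finset.sum_sub_distrib, ← Finset.smul_sum, hdiag, hmean, one_smul]
  simp_rw [smul_comm _ (1 / (Z : ℝ)), ← Finset.smul_sum]
  simp_rw [Finset.smul_sum (s := (Finset.univ : Finset (Fin Z)))]
  rw [Finset.sum_comm]
  simp_rw [hz]
  rw [Finset.sum_const, Finset.card_univ, Fintype.card_fin, ← Nat.cast_smul_eq_nsmul ℝ,
    smul_smul, smul_smul]
  congr 1
  field_simp

theorem sum_fderiv_eq_zero_of_sum_eq_one {E A : Type*} [NormedAddCommGroup E] [NormedSpace ℝ E]
    [Fintype A] {f : E → A → ℝ} {x : E} (hf : ∀ a, DifferentiableAt ℝ (fun y => f y a) x)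
    (hsum : ∀ y, ∑ a, f y a = 1) : ∑ a, fderiv ℝ (fun y => f y a) x = 0 := by
  rw [← fderiv_fun_sum fun a _ => hf a]
  simp [hsum]

theorem smul_fderiv_log {E : Type*} [NormedAddCommGroup E] [NormedSpace ℝ E]
    {f : E → ℝ} {x : E} (hf : DifferentiableAt ℝ f x) (hx : f x ≠ 0) (c : ℝ) :
    (f x * c) • fderiv ℝ (fun y => Real.log (f y)) x = c • fderiv ℝ f x := by
  rw [fderiv.log hf hx, smul_smul]
  congr 1
  field_simp


/-- Theorem 2 (overall policy gradient of the mixed objective): in expectation, the combined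
step-wise plus terminal loss gradient equals the gradient of the single mixed objective
`J_mix θ = α_step * ((Z-1)/Z) * ∑ t, ω t * J_t θ + α_term * J_seq θ`. -/
theorem overall_policy_gradient_mixed
    {E : Type*} [NormedAddCommGroup E] [NormedSpace ℝ E]
    {T Q S A O : Type*} [Fintype T] [Nonempty T] [Fintype Q] [Nonempty Q]
    [Fintype S] [Nonempty S] [Fintype A] [Nonempty A] [Fintype O] [Nonempty O]
    (π : E → S → A → ℝ) (Pi : E → Q → O → ℝ) (θ₀ θold : E)
    (ω : T → ℝ) (p : Q → ℝ) (d : T → Q → S → ℝ)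
    (r : Q → S → A → ℝ) (Rterm : Q → O → ℝ) (b : Q → ℝ)
    (hω : ∀ t, 0 ≤ ω t) (hωsum : ∑ t, ω t = 1)
    (hp : ∀ q, 0 ≤ p q) (hpsum : ∑ q, p q = 1)
    (hd : ∀ t q s, 0 ≤ d t q s) (hdsum : ∀ t q, ∑ s, d t q s = 1)
    (hπpos : ∀ θ s a, 0 < π θ s a)
    (hπsum : ∀ θ s, ∑ a, π θ s a = 1)
    (hπdiff : ∀ s a, DifferentiableAt ℝ (fun θ => π θ s a) θ₀)
    (hPipos : ∀ θ q o, 0 < Pi θ q o)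
    (hPisum : ∀ θ q, ∑ o, Pi θ q o = 1)
    (hPidiff : ∀ q o, DifferentiableAt ℝ (fun θ => Pi θ q o) θ₀)
    (Z : ℕ) (hZ : 1 ≤ Z) (αstep αterm : ℝ) :
    αstep •
        (∑ t, ω t •
          ∑ q, p q •
            ∑ s, d t q s •
              ∑ v : Fin Z → A,
                (∏ i, π θold s (v i)) •
                  ((1 / (Z : ℝ)) •
                    ∑ z : Fin Z,
                      ((π θ₀ s (v z) / π θold s (v z)) *
                          (r q s (v z) - (1 / (Z : ℝ)) * ∑ j : Fin Z, r q s (v j))) •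
                        fderiv ℝ (fun θ => Real.log (π θ s (v z))) θ₀))
      + αterm •
          (∑ q, p q •
            ∑ o, (Pi θold q o * (Pi θ₀ q o / Pi θold q o) * (Rterm q o - b q)) •
              fderiv ℝ (fun θ => Real.log (Pi θ q o)) θ₀)
      = fderiv ℝ
          (fun θ =>
            αstep * (((Z : ℝ) - 1) / (Z : ℝ)) *
                ∑ t, ω t * ∑ q, p q * ∑ s, d t q s * ∑ a, π θ s a * r q s a
              + αterm * ∑ q, p q * ∑ o, Pi θ q o * Rterm q o) θ₀ := by
  have hstep (q : Q) (s : S) :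
      ∑ v : Fin Z → A, (∏ i, π θold s (v i)) • ((1 / (Z : ℝ)) • ∑ z : Fin Z,
          ((π θ₀ s (v z) / π θold s (v z)) *
              (r q s (v z) - (1 / (Z : ℝ)) * ∑ j : Fin Z, r q s (v j))) •
            fderiv ℝ (fun θ => Real.log (π θ s (v z))) θ₀) =
        (((Z : ℝ) - 1) / Z) • ∑ a, r q s a • fderiv ℝ (fun θ => π θ s a) θ₀ := by
    have hF (a : A) (c : ℝ) : (π θ₀ s a / π θold s a * c) •
        fderiv ℝ (fun θ => Real.log (π θ s a)) θ₀ =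
        c • ((π θold s a)⁻¹ • fderiv ℝ (fun θ => π θ s a) θ₀) := by
      rw [div_eq_mul_inv, mul_assoc, smul_fderiv_log (hπdiff s a) (hπpos θ₀ s a).ne', smul_smul,
        mul_comm c]
    have hcancel (a : A) (x : E →L[ℝ] ℝ) : π θold s a • ((π θold s a)⁻¹ • x) = x :=
      smul_inv_smul₀ (hπpos θold s a).ne' x
    simp_rw [hF]
    rw [sum_pi_prod_smul_group_mean_baseline (π θold s) (hπsum θold s)
      (fun a => (π θold s a)⁻¹ • fderiv ℝ (fun θ => π θ s a) θ₀) _ (r q s) hZ]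
    · simp_rw [smul_comm (π θold s _) (r q s _), hcancel]
    · simp_rw [hcancel]
      exact sum_fderiv_eq_zero_of_sum_eq_one (hπdiff s) fun θ => hπsum θ s
  have hterm (q : Q) :
      ∑ o, (Pi θold q o * (Pi θ₀ q o / Pi θold q o) * (Rterm q o - b q)) •
          fderiv ℝ (fun θ => Real.log (Pi θ q o)) θ₀ =
        ∑ o, Rterm q o • fderiv ℝ (fun θ => Pi θ q o) θ₀ := by
    simp_rw [mul_div_cancel₀ _ (hPipos θold q _).ne',
      smul_fderiv_log (hPidiff q _) (hPipos θ₀ q _).ne', sub_smul]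
    rw [Finset.sum_sub_distrib, ← Finset.smul_sum,
      sum_fderiv_eq_zero_of_sum_eq_one (hPidiff q) fun θ => hPisum θ q, smul_zero, sub_zero]
  have hJstep := HasFDerivAt.fun_sum (u := Finset.univ) fun t _ =>
    (HasFDerivAt.fun_sum (u := Finset.univ) fun q _ =>
      (HasFDerivAt.fun_sum (u := Finset.univ) fun s _ =>
        (HasFDerivAt.fun_sum (u := Finset.univ) fun a _ =>
          (hπdiff s a).hasFDerivAt.mul_const (r q s a)).const_mul (d t q s)).const_mul
            (p q)).const_mul (ω t)
  have hJterm := HasFDerivAt.fun_sum (u := Finset.univ) fun q _ =>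
    (HasFDerivAt.fun_sum (u := Finset.univ) fun o _ =>
      (hPidiff q o).hasFDerivAt.mul_const (Rterm q o)).const_mul (p q)
  refine Eq.trans ?_ ((hJstep.const_mul _).fun_add (hJterm.const_mul αterm)).fderiv.symm
  simp_rw [hstep, hterm, smul_comm _ (((Z : ℝ) - 1) / (Z : ℝ)), ← Finset.smul_sum,
    smul_comm _ (((Z : ℝ) - 1) / (Z : ℝ)), ← Finset.smul_sum,
    smul_comm _ (((Z : ℝ) - 1) / (Z : ℝ)), ← Finset.smul_sum, mul_smul]
end
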